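/- For every integer d ≥ 1, every real t with |t| < 1 and every k ∈ ℝ^d, the Fourier transforms of the ground-state densities satisfy the generating function identity Σ_{M=0}^∞ t^M ∫_{ℝ^d} ρ^{M,d}(x) e^{i ⟨k, x⟩} dx = (1 - t)^{-(d+1)} exp(-‖k‖²/4) exp( - t ‖k‖² / (2(1 - t)) ). -/

import Mathlib

open MeasureTheory Real

/-- Physicists' Hermite polynomials: `H 0 = 1`, `H 1 x = 2x`,
`H (n+2) x = 2x H (n+1) x - 2(n+1) H n x`. -/
noncomputable def hermiteH : ℕ → ℝ → ℝ
  | 0 => fun _ => 1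
  | 1 => fun x => 2 * x
  | (n + 2) => fun x => 2 * x * hermiteH (n + 1) x - 2 * (n + 1) * hermiteH n x

/-- Normalised harmonic oscillator eigenfunctions. -/
noncomputable def ψho (l : ℕ) (x : ℝ) : ℝ :=
  (Real.sqrt (2 ^ l * (Nat.factorial l) * Real.sqrt π))⁻¹ * hermiteH l x * Real.exp (-x ^ 2 / 2)

/-- Ground-state density of the `d`-dimensional harmonically trapped Fermi gas,
shell label `M`: sum over occupation arrays `l ∈ ℕ^d` with `l 1 + ⋯ + l d ≤ M`. -/
noncomputable def fermiDensity (d M : ℕ) (x : EuclideanSpace ℝ (Fin d)) : ℝ :=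
  ∑ l ∈ Finset.filter (fun l => ∑ j, l j ≤ M)
      (Fintype.piFinset fun _ : Fin d => Finset.range (M + 1)),
    ∏ j, (ψho (l j) (x j)) ^ 2

/-- Generalised Laguerre polynomial `L_n^{(α)}` with natural parameter `α`. -/
noncomputable def laguerreL (n α : ℕ) (x : ℝ) : ℝ :=
  ∑ k ∈ Finset.range (n + 1),
    (-1 : ℝ) ^ k * (Nat.choose (n + α) (n - k) : ℝ) * x ^ k / (Nat.factorial k : ℝ)


lemma lag_gf (t y : ℝ) (ht : |t| < 1) :
    HasSum (fun n : ℕ => t ^ n * ∑ j ∈ Finset.range (n + 1), (n.choose j : ℝ) * y ^ j / (j.factorial : ℝ))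
      ((1 - t)⁻¹ * Real.exp (t * y / (1 - t))) := by
  have key : ∀ (s z : ℝ), |s| < 1 → ∀ j : ℕ,
      HasSum (fun m : ℕ => s ^ (m + j) * (((m + j).choose j : ℝ) * z ^ j / (j.factorial : ℝ)))
        ((1 - s)⁻¹ * ((s * z / (1 - s)) ^ j / (j.factorial : ℝ))) := by
    intro s z hs j
    have h := (hasSum_choose_mul_geometric_of_norm_lt_one j (r := s) (by simpa using hs)).mul_left
      (s ^ j * z ^ j / (j.factorial : ℝ))
    have h1 : (1 - s) ≠ 0 := by
      have := (abs_lt.1 hs).2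
      linarith
    convert! h using 1
    · ext m; ring
    · rw [div_pow, mul_pow]; field_simp; ring
  have hexp : ∀ (s z : ℝ), HasSum (fun j : ℕ => (1 - s)⁻¹ * ((s * z / (1 - s)) ^ j / (j.factorial : ℝ)))
      ((1 - s)⁻¹ * Real.exp (s * z / (1 - s))) := by
    intro s z
    have := NormedSpace.expSeries_div_hasSum_exp (s * z / (1 - s))
    rw [← Real.exp_eq_exp_ℝ] at this
    exact this.mul_left _
  have hs : Summable (fun p : ℕ × ℕ =>
      t ^ (p.2 + p.1) * (((p.2 + p.1).choose p.1 : ℝ) * y ^ p.1 / (p.1.factorial : ℝ))) := by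
    apply Summable.of_norm
    have e : (fun p : ℕ × ℕ =>
      ‖t ^ (p.2 + p.1) * (((p.2 + p.1).choose p.1 : ℝ) * y ^ p.1 / (p.1.factorial : ℝ))‖) =
      (fun p : ℕ × ℕ =>
      |t| ^ (p.2 + p.1) * (((p.2 + p.1).choose p.1 : ℝ) * |y| ^ p.1 / (p.1.factorial : ℝ))) := by
      ext p
      simp [abs_mul, abs_div, abs_pow]
    rw [e]
    have k2 := key |t| |y| (by simpa using ht)
    rw [summable_prod_of_nonneg (fun p => by positivity)]
    refine ⟨fun j => (k2 j).summable, ?_⟩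
    have : (fun j : ℕ => ∑' m : ℕ, |t| ^ (m + j) * (((m + j).choose j : ℝ) * |y| ^ j / (j.factorial : ℝ)))
      = fun j : ℕ => (1 - |t|)⁻¹ * ((|t| * |y| / (1 - |t|)) ^ j / (j.factorial : ℝ)) := by
      ext j; exact (k2 j).tsum_eq
    simp only
    rw [this]
    exact (hexp _ _).summable
  have hS := hs.hasSum
  have h2 := hS.prod_fiberwise (key t y ht)
  rw [h2.unique (hexp t y)] at hS
  have inj : Function.Injective (fun p : ℕ × ℕ => (p.2 + p.1, p.1)) := by
    rintro ⟨a, b⟩ ⟨c, d⟩ h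
    simp only [Prod.mk.injEq] at h ⊢
    omega
  have h3 := (inj.hasSum_iff (f := fun q : ℕ × ℕ =>
      t ^ q.1 * ((q.1.choose q.2 : ℝ) * y ^ q.2 / (q.2.factorial : ℝ)))
      (a := (1 - t)⁻¹ * Real.exp (t * y / (1 - t))) ?_).1 hS
  · refine h3.prod_fiberwise fun n => ?_
    rw [Finset.mul_sum]
    apply hasSum_sum_of_ne_finset_zero
    intro j hj
    rw [Nat.choose_eq_zero_of_lt (by simpa using hj)]
    simp
  · rintro ⟨n, j⟩ hx
    have : n < j := by
      by_contra hc
      exact hx ⟨(j, n - j), by simp; omega⟩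
    simp [Nat.choose_eq_zero_of_lt this]

lemma hasSum_mul_aux {α β : Type} {f : α → ℂ} {g : β → ℂ} {a b : ℂ} (hf : HasSum f a)
    (hg : HasSum g b) : HasSum (fun x : α × β => f x.1 * g x.2) (a * b) :=
  hf.mul hg (summable_mul_of_summable_norm (f := f) (g := g) hf.summable.norm hg.summable.norm)

lemma hasSum_pi (d : ℕ) (g : Fin d → ℕ → ℂ) (G : Fin d → ℂ) (h : ∀ j, HasSum (g j) (G j)) :
    HasSum (fun l : Fin d → ℕ => ∏ j, g j (l j)) (∏ j, G j) := by
  induction d with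
  | zero => simpa using hasSum_unique (fun l : Fin 0 → ℕ => ∏ j, g j (l j))
  | succ d ih =>
    have h1 : HasSum (fun l : Fin d → ℕ => ∏ j : Fin d, g j.succ (l j)) (∏ j : Fin d, G j.succ) :=
      ih (fun j => g j.succ) (fun j => G j.succ) (fun j => h j.succ)
    have h2 := hasSum_mul_aux (h 0) h1
    rw [Fin.prod_univ_succ, ← (Fin.consEquiv (fun _ => ℕ)).hasSum_iff]
    convert h2 using 1
    ext p
    simp [Fin.prod_univ_succ, Fin.consEquiv]

lemma hasSum_shell (d : ℕ) (t : ℝ) (ht : |t| < 1) (c : (Fin d → ℕ) → ℂ) (S : ℂ)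
    (h : HasSum (fun l => (t : ℂ) ^ (∑ j, l j) * c l) S) :
    HasSum (fun M : ℕ => (t : ℂ) ^ M * ∑ l ∈ Finset.filter (fun l => ∑ j, l j ≤ M)
      (Fintype.piFinset fun _ : Fin d => Finset.range (M + 1)), c l) ((1 - (t : ℂ))⁻¹ * S) := by
  have hg : HasSum (fun m : ℕ => (t : ℂ) ^ m) (1 - (t : ℂ))⁻¹ :=
    hasSum_geometric_of_norm_lt_one (by simpa using ht)
  have h2 := hg.mul h (summable_mul_of_summable_norm (f := fun m : ℕ => (t : ℂ) ^ m)
    (g := fun l : Fin d → ℕ => (t : ℂ) ^ (∑ j, l j) * c l) hg.summable.norm h.summable.norm)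
  have inj : Function.Injective (fun p : ℕ × (Fin d → ℕ) => (p.1 + ∑ j, p.2 j, p.2)) := by
    rintro ⟨a, b⟩ ⟨c, d⟩ h
    simp only [Prod.mk.injEq] at h ⊢
    obtain ⟨h1, rfl⟩ := h
    exact ⟨by omega, rfl⟩
  have h3 := (inj.hasSum_iff (f := fun q : ℕ × (Fin d → ℕ) =>
      if ∑ j, q.2 j ≤ q.1 then (t : ℂ) ^ q.1 * c q.2 else 0) (a := (1 - (t : ℂ))⁻¹ * S) ?_).1 ?_
  · refine h3.prod_fiberwise fun M => ?_
    rw [Finset.mul_sum, Finset.sum_filter]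
    apply hasSum_sum_of_ne_finset_zero
    intro l hl
    rw [if_neg]
    intro hc
    apply hl
    simp only [Fintype.mem_piFinset, Finset.mem_range]
    intro i
    have := Finset.single_le_sum (f := l) (fun j _ => Nat.zero_le _) (Finset.mem_univ i)
    exact Nat.lt_succ_of_le (this.trans hc)
  · rintro ⟨M, l⟩ hx
    simp only
    rw [if_neg]
    intro hc
    exact hx ⟨(M - ∑ j, l j, l), by simp; omega⟩
  · convert! h2 using 1
    ext p
    simp [pow_add, mul_assoc]

lemma herm_succ (n : ℕ) (x : ℝ) :
    hermiteH (n + 1) x = 2 * x * hermiteH n x - 2 * n * hermiteH (n - 1) x := by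
  cases n with
  | zero => simp [hermiteH]
  | succ n => simp [hermiteH]

lemma herm_deriv (n : ℕ) : ∀ x : ℝ, HasDerivAt (hermiteH n) (2 * n * hermiteH (n - 1) x) x := by
  induction n using Nat.strong_induction_on with
  | _ n ih =>
    intro x
    match n with
    | 0 => simpa [hermiteH] using hasDerivAt_const x (1 : ℝ)
    | 1 => simpa [hermiteH] using (hasDerivAt_id x).const_mul (2 : ℝ)
    | n + 2 =>
      have h1 := ih (n + 1) (by omega) x
      have h0 := ih n (by omega) x
      have e : hermiteH (n + 2) = fun x => 2 * x * hermiteH (n + 1) x - 2 * (n + 1) * hermiteH n x := by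
        ext x; simp [hermiteH]
      rw [e]
      have h := (((hasDerivAt_id x).const_mul (2 : ℝ)).mul h1).sub (h0.const_mul (2 * ((n : ℝ) + 1)))
      convert! h using 1
      have h2 := herm_succ n x
      simp only [Nat.add_sub_cancel, show n + 2 - 1 = n + 1 by omega, id]
      rw [h2]
      push_cast
      ring

lemma herm_poly (n : ℕ) : ∃ P : Polynomial ℝ, ∀ x, hermiteH n x = P.eval x := by
  induction n using Nat.strong_induction_on with
  | _ n ih =>
    match n with
    | 0 => exact ⟨1, by simp [hermiteH]⟩
    | 1 => exact ⟨2 * Polynomial.X, by simp [hermiteH]⟩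
    | n + 2 =>
      obtain ⟨P, hP⟩ := ih (n + 1) (by omega)
      obtain ⟨Q, hQ⟩ := ih n (by omega)
      exact ⟨2 * Polynomial.X * P - Polynomial.C (2 * ((n : ℝ) + 1)) * Q, by
        intro x; simp [hermiteH, hP, hQ]⟩

lemma poly_int (P : Polynomial ℝ) : Integrable (fun x : ℝ => P.eval x * Real.exp (-x ^ 2)) := by
  induction P using Polynomial.induction_on' with
  | add p q hp hq =>
    simp only [Polynomial.eval_add, add_mul]
    exact hp.add hq
  | monomial n a =>
    have := (integrable_rpow_mul_exp_neg_mul_sq (b := 1) one_pos (s := n)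
      (by have : (0 : ℝ) ≤ n := n.cast_nonneg
          linarith)).const_mul a
    convert! this using 1
    ext x
    simp [mul_assoc]

noncomputable def hJ (k : ℝ) (a b : ℕ) (x : ℝ) : ℂ :=
  ((hermiteH a x * hermiteH b x * Real.exp (-x ^ 2) : ℝ) : ℂ) * Complex.exp (Complex.I * ((k * x : ℝ) : ℂ))

lemma hJ_int (k : ℝ) (a b : ℕ) : Integrable (hJ k a b) := by
  obtain ⟨P, hP⟩ := herm_poly a
  obtain ⟨Q, hQ⟩ := herm_poly b
  have h := (poly_int (P * Q)).ofReal (𝕜 := ℂ)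
  have h2 := h.bdd_mul (f := fun x : ℝ => Complex.exp (Complex.I * ((k * x : ℝ) : ℂ))) (c := 1)
    (by fun_prop) (by
      filter_upwards with x
      rw [mul_comm Complex.I, Complex.norm_exp_ofReal_mul_I])
  convert! h2 using 1
  ext x
  simp [hJ, hP, hQ, mul_comm]

noncomputable def IJ (k : ℝ) (a b : ℕ) : ℂ := ∫ x, hJ k a b x

lemma IJ_symm (k : ℝ) (a b : ℕ) : IJ k a b = IJ k b a := by
  unfold IJ hJ
  congr 1; ext x
  rw [mul_comm (hermiteH a x)]

lemma IJ_succ (k : ℝ) (a b : ℕ) :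
    IJ k (a + 1) b = Complex.I * k * IJ k a b + 2 * b * IJ k a (b - 1) := by
  have hd : ∀ x, HasDerivAt (hJ k a b)
      (Complex.I * k * hJ k a b x + 2 * b * hJ k a (b - 1) x - hJ k (a + 1) b x) x := by
    intro x
    have hE : HasDerivAt (fun x : ℝ => Real.exp (-x ^ 2)) (Real.exp (-x ^ 2) * (-(2 * x))) x := by
      have := ((hasDerivAt_pow 2 x).neg).exp
      simpa using this
    have h1 := ((((herm_deriv a x).mul (herm_deriv b x)).mul hE)).ofReal_comp
    have h2 : HasDerivAt (fun x : ℝ => Complex.exp (Complex.I * ((k * x : ℝ) : ℂ)))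
        (Complex.exp (Complex.I * ((k * x : ℝ) : ℂ)) * (Complex.I * k)) x := by
      have := ((((hasDerivAt_id x).const_mul k).ofReal_comp).const_mul Complex.I).cexp
      simpa using this
    have h := h1.mul h2
    convert! h using 1
    simp only [hJ, herm_succ a x, Pi.mul_apply]
    push_cast
    ring
  have i1 := (hJ_int k a b).const_mul (Complex.I * k)
  have i2 := (hJ_int k a (b - 1)).const_mul (2 * (b : ℂ))
  have i3 := hJ_int k (a + 1) b
  have := integral_eq_zero_of_hasDerivAt_of_integrable hd ((i1.add i2).sub i3) (hJ_int k a b)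
  have i12 : Integrable (fun x => Complex.I * k * hJ k a b x + 2 * (b : ℂ) * hJ k a (b - 1) x) := i1.add i2
  rw [integral_sub i12 i3, integral_add i1 i2, integral_const_mul, integral_const_mul] at this
  unfold IJ
  linear_combination -this

lemma IJ_zero_zero (k : ℝ) : IJ k 0 0 = ((Real.sqrt π * Real.exp (-k ^ 2 / 4) : ℝ) : ℂ) := by
  have h := fourierIntegral_gaussian (b := 1) (by simp) (k : ℂ)
  unfold IJ hJ
  simp only [hermiteH]
  rw [Real.sqrt_eq_rpow, Complex.ofReal_mul, Complex.ofReal_cpow pi_pos.le]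
  push_cast
  convert! h using 1
  · congr 1; ext x; ring_nf
  · simp

lemma IJ_zero (k : ℝ) (b : ℕ) : IJ k 0 b = (Complex.I * k) ^ b * IJ k 0 0 := by
  rw [IJ_symm]
  induction b with
  | zero => simp
  | succ b ih => rw [IJ_succ, ih]; simp; ring

noncomputable def shT : Module.End ℂ (ℕ → ℂ) where
  toFun f b := 2 * b * f (b - 1)
  map_add' f g := by ext b; simp; ring
  map_smul' c f := by ext b; simp; ring

lemma shT_pow (j : ℕ) (f : ℕ → ℂ) (b : ℕ) :
    (shT ^ j) f b = 2 ^ j * (b.descFactorial j : ℂ) * f (b - j) := by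
  induction j generalizing b with
  | zero => simp
  | succ j ih =>
    rw [pow_succ', Module.End.mul_apply]
    change 2 * (b : ℂ) * (shT ^ j) f (b - 1) = _
    rw [ih]
    cases b with
    | zero => simp
    | succ b =>
      rw [Nat.succ_descFactorial_succ]
      simp only [Nat.add_sub_cancel, Nat.add_sub_add_right]
      push_cast
      ring

lemma IJ_eq (k : ℝ) (a : ℕ) :
    IJ k a = ((shT + algebraMap ℂ (Module.End ℂ (ℕ → ℂ)) (Complex.I * k)) ^ a) (IJ k 0) := by
  induction a with
  | zero => simp
  | succ a ih =>
    rw [pow_succ', Module.End.mul_apply, ← ih]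
    ext b
    rw [IJ_succ]
    simp [shT]
    ring

lemma IJ_diag (k : ℝ) (n : ℕ) :
    IJ k n n = ((2 ^ n * (n.factorial : ℝ) * (Real.sqrt π * Real.exp (-k ^ 2 / 4) *
      ∑ j ∈ Finset.range (n + 1), (n.choose j : ℝ) * (-k ^ 2 / 2) ^ j / (j.factorial : ℝ)) : ℝ) : ℂ) := by
  rw [IJ_eq, Commute.add_pow (Algebra.commutes _ _).symm, ← Finset.sum_range_reflect]
  rw [LinearMap.sum_apply, Finset.sum_apply]
  simp only [Complex.ofReal_mul, Complex.ofReal_sum, Complex.ofReal_div, Complex.ofReal_pow,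
    Complex.ofReal_natCast, Complex.ofReal_neg, Complex.ofReal_ofNat]
  simp only [Finset.mul_sum]
  apply Finset.sum_congr rfl
  intro j hj
  have hj' : j ≤ n := by simpa [Nat.lt_succ_iff] using hj
  rw [show n + 1 - 1 - j = n - j by omega, show n - (n - j) = j by omega]
  rw [← map_pow, ← nsmul_eq_mul', LinearMap.smul_apply, Module.End.mul_apply, Pi.smul_apply, shT_pow,
    Module.algebraMap_end_apply, Pi.smul_apply, show n - (n - j) = j by omega, IJ_zero, IJ_zero_zero,
    Nat.choose_symm hj']
  have h1 : (n.descFactorial (n - j) : ℂ) = n.factorial / j.factorial := by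
    rw [eq_div_iff (by exact_mod_cast j.factorial_ne_zero)]
    have := Nat.factorial_mul_descFactorial (n := n) (k := n - j) (by omega)
    rw [show n - (n - j) = j by omega] at this
    rw [mul_comm]
    exact_mod_cast this
  have h2 : (2 : ℂ) ^ n = 2 ^ (n - j) * 2 ^ j := by rw [← pow_add]; congr 1; omega
  have h3 : (-(k : ℂ) ^ 2 / 2) ^ j = (Complex.I * k) ^ j * (Complex.I * k) ^ j / 2 ^ j := by
    rw [← mul_pow, ← div_pow]
    congr 2
    linear_combination (-(k : ℂ)^2) * Complex.I_mul_I
  rw [h1, h2, h3]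
  simp only [nsmul_eq_mul, smul_eq_mul]
  push_cast
  field_simp

lemma psi_sq (l : ℕ) (k x : ℝ) :
    ((ψho l x ^ 2 : ℝ) : ℂ) * Complex.exp (Complex.I * ((k * x : ℝ) : ℂ)) =
      (((2 ^ l * (Nat.factorial l) * Real.sqrt π)⁻¹ : ℝ) : ℂ) * hJ k l l x := by
  have : ψho l x ^ 2 = (2 ^ l * (Nat.factorial l) * Real.sqrt π)⁻¹ *
      (hermiteH l x * hermiteH l x * Real.exp (-x ^ 2)) := by
    unfold ψho
    rw [mul_pow, mul_pow, inv_pow, Real.sq_sqrt (by positivity), ← Real.exp_nat_mul]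
    rw [show ((2 : ℕ) : ℝ) * (-x ^ 2 / 2) = -x ^ 2 by push_cast; ring]
    ring
  rw [this, hJ]
  push_cast
  ring

lemma psi_int (l : ℕ) (k : ℝ) : Integrable (fun x : ℝ =>
    ((ψho l x ^ 2 : ℝ) : ℂ) * Complex.exp (Complex.I * ((k * x : ℝ) : ℂ))) := by
  simp only [psi_sq]
  exact (hJ_int k l l).const_mul _

lemma psi_fourier (l : ℕ) (k : ℝ) :
    ∫ x : ℝ, ((ψho l x ^ 2 : ℝ) : ℂ) * Complex.exp (Complex.I * ((k * x : ℝ) : ℂ)) =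
      ((Real.exp (-k ^ 2 / 4) *
      ∑ j ∈ Finset.range (l + 1), (l.choose j : ℝ) * (-k ^ 2 / 2) ^ j / (j.factorial : ℝ) : ℝ) : ℂ) := by
  simp only [psi_sq]
  rw [integral_const_mul]
  change _ * IJ k l l = _
  rw [IJ_diag, ← Complex.ofReal_mul]
  congr 1
  have : Real.sqrt π ≠ 0 := by positivity
  have : (l.factorial : ℝ) ≠ 0 := by positivity
  field_simp

lemma psi_gf (t : ℝ) (ht : |t| < 1) (k : ℝ) :
    HasSum (fun l : ℕ => (t : ℂ) ^ l *
      ∫ x : ℝ, ((ψho l x ^ 2 : ℝ) : ℂ) * Complex.exp (Complex.I * ((k * x : ℝ) : ℂ)))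
      (((1 - t)⁻¹ * (Real.exp (-k ^ 2 / 4) * Real.exp (-(t * k ^ 2) / (2 * (1 - t)))) : ℝ) : ℂ) := by
  have h := (lag_gf t (-k ^ 2 / 2) ht).mul_left (Real.exp (-k ^ 2 / 4))
  have h' := (Complex.hasSum_ofReal).2 h
  convert! h' using 1
  · ext l
    rw [psi_fourier]
    push_cast
    ring
  · congr 1
    have : t * (-k ^ 2 / 2) / (1 - t) = -(t * k ^ 2) / (2 * (1 - t)) := by
      rw [mul_div_assoc', div_div]; ring
    rw [this]; ring

lemma density_fourier (d M : ℕ) (k : EuclideanSpace ℝ (Fin d)) :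
    ∫ x : EuclideanSpace ℝ (Fin d),
          (fermiDensity d M x : ℂ) * Complex.exp (Complex.I * (inner ℝ k x : ℝ)) =
    ∑ l ∈ Finset.filter (fun l => ∑ j, l j ≤ M)
      (Fintype.piFinset fun _ : Fin d => Finset.range (M + 1)),
      ∏ j, ∫ x : ℝ, ((ψho (l j) x ^ 2 : ℝ) : ℂ) * Complex.exp (Complex.I * ((k j * x : ℝ) : ℂ)) := by
  have e : ∀ x : EuclideanSpace ℝ (Fin d),
      (fermiDensity d M x : ℂ) * Complex.exp (Complex.I * (inner ℝ k x : ℝ)) =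
      (fun y : Fin d → ℝ => ∑ l ∈ Finset.filter (fun l => ∑ j, l j ≤ M)
      (Fintype.piFinset fun _ : Fin d => Finset.range (M + 1)),
      ∏ j, (((ψho (l j) (y j) ^ 2 : ℝ) : ℂ) * Complex.exp (Complex.I * ((k j * y j : ℝ) : ℂ))))
      (MeasurableEquiv.toLp 2 (Fin d → ℝ) |>.symm x) := by
    intro x
    simp only [fermiDensity, Complex.ofReal_sum, Finset.sum_mul, Complex.ofReal_prod,
      Finset.prod_mul_distrib]
    apply Finset.sum_congr rfl
    intro l _
    rw [← Complex.exp_sum, ← Finset.mul_sum, ← Complex.ofReal_sum]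
    simp [PiLp.inner_apply, mul_comm]
  simp only [e]
  rw [(EuclideanSpace.volume_preserving_symm_measurableEquiv_toLp (Fin d)).integral_comp'
    (g := (fun y : Fin d → ℝ => ∑ l ∈ Finset.filter (fun l => ∑ j, l j ≤ M)
      (Fintype.piFinset fun _ : Fin d => Finset.range (M + 1)),
      ∏ j, (((ψho (l j) (y j) ^ 2 : ℝ) : ℂ) * Complex.exp (Complex.I * ((k j * y j : ℝ) : ℂ)))))]
  rw [integral_finsetSum]
  · apply Finset.sum_congr rfl
    intro l _
    exact integral_fintype_prod_volume_eq_prod (fun j (x : ℝ) =>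
      ((ψho (l j) x ^ 2 : ℝ) : ℂ) * Complex.exp (Complex.I * ((k j * x : ℝ) : ℂ)))
  · intro l _
    exact Integrable.fintype_prod (f := fun j (x : ℝ) =>
      ((ψho (l j) x ^ 2 : ℝ) : ℂ) * Complex.exp (Complex.I * ((k j * x : ℝ) : ℂ)))
      (fun j => psi_int (l j) (k j))

open scoped RealInnerProductSpace in
/-- generating function of the Fourier transforms of the densities:
`Σ_M t^M ∫ ρ^{M,d}(x) e^{i⟨k,x⟩} dx = (1-t)^{-(d+1)} e^{-‖k‖²/4} e^{-t‖k‖²/(2(1-t))}`. -/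
theorem fermi_density_fourier_generating_function (d : ℕ) (hd : 1 ≤ d)
    (t : ℝ) (ht : |t| < 1) (k : EuclideanSpace ℝ (Fin d)) :
    HasSum (fun M : ℕ => (t : ℂ) ^ M *
        ∫ x : EuclideanSpace ℝ (Fin d),
          (fermiDensity d M x : ℂ) * Complex.exp (Complex.I * (⟪k, x⟫ : ℝ)))
      ((((1 - t) ^ (d + 1))⁻¹ * Real.exp (-‖k‖ ^ 2 / 4) *
          Real.exp (-(t * ‖k‖ ^ 2) / (2 * (1 - t))) : ℝ) : ℂ) := by
  simp only [density_fourier]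
  have h := hasSum_pi d _ _ (fun j => psi_gf t ht (k j))
  simp only [Finset.prod_mul_distrib, Finset.prod_pow_eq_pow_sum] at h
  have h2 := hasSum_shell d t ht _ _ h
  convert! h2 using 1
  simp only [← Complex.ofReal_prod, Finset.prod_mul_distrib, ← Real.exp_sum, Finset.prod_const,
    Finset.card_univ, Fintype.card_fin]
  rw [← Complex.ofReal_one, ← Complex.ofReal_sub, ← Complex.ofReal_inv, ← Complex.ofReal_mul]
  congr 1
  rw [EuclideanSpace.real_norm_sq_eq, ← Finset.sum_div, ← Finset.sum_div, Finset.sum_neg_distrib,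
    Finset.sum_neg_distrib, Finset.mul_sum, pow_succ, mul_inv, inv_pow]
  ring
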